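/- Let α ∈ (0, 1/2) and f(z) = ((z−1)/(z+1))^α, taking the branch holomorphic on ℂ \ [−1, 1] with f(∞) = 1, and let Q_{n,0}, Q_{n,1}, Q_{n,2} be Hermite–Padé polynomials of order n for (1, f, f^2). Then for each j = 0, 1, 2 all zeros of Q_{n,j} lie in ℝ \ [−1, 1]. -/

import Mathlib

open Polynomial Filter Topology

theorem mul_prod_sub_eq_of_moments {ι : Type*} [DecidableEq ι] (s : Finset ι) (lam c : ι → ℂ)
    (h : ∀ m, m + 1 < s.card → ∑ i ∈ s, c i * lam i ^ m = 0) {i i' : ι} (hi : i ∈ s)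
    (hi' : i' ∈ s) :
    c i * ∏ l ∈ s.erase i, (lam i - lam l) = c i' * ∏ l ∈ s.erase i', (lam i' - lam l) := by
  rcases eq_or_ne i i' with rfl | hne
  · rfl
  set u := (s.erase i).erase i' with hu
  set q : ℂ[X] := ∏ l ∈ u, (X - C (lam l)) with hq
  have hi'e : i' ∈ s.erase i := Finset.mem_erase.2 ⟨hne.symm, hi'⟩
  have hie : i ∈ s.erase i' := Finset.mem_erase.2 ⟨hne, hi⟩
  have hcard : u.card + 2 = s.card := by
    have h1 := Finset.card_erase_add_one hi
    have h2 := Finset.card_erase_add_one hi'e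
    rw [← hu] at h2
    omega
  have hdeg : q.natDegree = u.card := natDegree_finsetProd_X_sub_C_eq_card u lam
  have hsum : ∑ l ∈ s, c l * q.eval (lam l) = 0 := by
    simp_rw [eval_eq_sum_range, Finset.mul_sum]
    rw [Finset.sum_comm]
    refine Finset.sum_eq_zero fun m hm => ?_
    have hm' := Finset.mem_range.1 hm
    have := h m (by omega)
    calc ∑ l ∈ s, c l * (q.coeff m * lam l ^ m) = q.coeff m * ∑ l ∈ s, c l * lam l ^ m := by
          rw [Finset.mul_sum]; exact Finset.sum_congr rfl fun _ _ => by ring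
      _ = 0 := by rw [this, mul_zero]
  rw [← Finset.add_sum_erase s _ hi, ← Finset.add_sum_erase _ _ hi'e,
    Finset.sum_eq_zero (s := (s.erase i).erase i'), add_zero] at hsum
  · rw [← Finset.mul_prod_erase _ _ hi'e, ← Finset.mul_prod_erase _ _ hie,
      Finset.erase_right_comm (a := i') (b := i)]
    simp only [hq, eval_prod, eval_sub, eval_X, eval_C] at hsum
    rw [← hu]
    linear_combination (lam i - lam i') * hsum
  · intro l hl
    rw [hq, eval_prod, Finset.prod_eq_zero hl (by simp), mul_zero]

theorem moments_eq_zero_of_exp_sum_le {ι : Type*} (s : Finset ι) (lam c : ι → ℂ) (K : ℕ) (C : ℝ)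
    (h : ∀ᶠ t : ℝ in 𝓝[<] 0, ‖∑ i ∈ s, c i * Complex.exp (lam i * t)‖ ≤ C * |t| ^ K) :
    ∀ m < K, ∑ i ∈ s, c i * lam i ^ m = 0 := by
  intro m
  induction m using Nat.strong_induction_on with
  | _ m ih =>
  intro hm
  set μ := ∑ i ∈ s, c i * lam i ^ m with hμ
  have hlim : Tendsto (fun t : ℝ => (t : ℂ)) (𝓝[<] 0) (𝓝 0) := by
    have : Tendsto (fun t : ℝ => (t : ℂ)) (𝓝 0) (𝓝 ((0 : ℝ) : ℂ)) :=
      Complex.continuous_ofReal.tendsto 0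
    simpa using this.mono_left nhdsWithin_le_nhds
  have hG : (fun t : ℝ => ∑ i ∈ s, c i * Complex.exp (lam i * t)) =O[𝓝[<] 0]
      fun t : ℝ => (t : ℂ) ^ (m + 1) := by
    refine Asymptotics.IsBigO.of_bound |C| ?_
    have h1 : ∀ᶠ t : ℝ in 𝓝[<] 0, t ∈ Set.Ioo (-1 : ℝ) 0 := Ioo_mem_nhdsLT (by norm_num)
    filter_upwards [h, h1] with t ht ht1
    refine ht.trans ?_
    rw [norm_pow, Complex.norm_real, Real.norm_eq_abs]
    have h2 : |t| ≤ 1 := abs_le.2 ⟨ht1.1.le, by linarith [ht1.2]⟩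
    have h3 : |t| ^ K ≤ |t| ^ (m + 1) := pow_le_pow_of_le_one (abs_nonneg _) h2 hm
    exact mul_le_mul (le_abs_self C) h3 (by positivity) (abs_nonneg _)
  have hT : ∀ i ∈ s, (fun t : ℝ => c i * (Complex.exp (lam i * t) -
      ∑ k ∈ Finset.range (m + 1), (lam i * t) ^ k / (k.factorial : ℂ))) =O[𝓝[<] 0]
      fun t : ℝ => (t : ℂ) ^ (m + 1) := by
    intro i _
    have h0 : Tendsto (fun t : ℝ => lam i * (t : ℂ)) (𝓝[<] 0) (𝓝 0) := by
      simpa using hlim.const_mul (lam i)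
    have h1 := (Complex.exp_sub_sum_range_isBigO_pow (m + 1)).comp_tendsto h0
    refine Asymptotics.IsBigO.const_mul_left (h1.trans ?_) _
    have : (fun t : ℝ => lam i ^ (m + 1) * (t : ℂ) ^ (m + 1)) =O[𝓝[<] 0]
      fun t : ℝ => (t : ℂ) ^ (m + 1) := (Asymptotics.isBigO_refl _ _).const_mul_left _
    simpa [Function.comp_def, mul_pow] using this
  have hdiff := hG.sub (Asymptotics.IsBigO.sum hT)
  have heq : (fun t : ℝ => μ / (m.factorial : ℂ) * (t : ℂ) ^ m) =O[𝓝[<] 0]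
      fun t : ℝ => (t : ℂ) ^ (m + 1) := by
    refine hdiff.congr_left fun t => ?_
    rw [Finset.sum_apply, ← Finset.sum_sub_distrib]
    have : ∀ i ∈ s, c i * Complex.exp (lam i * t) - c i * (Complex.exp (lam i * t) -
        ∑ k ∈ Finset.range (m + 1), (lam i * t) ^ k / (k.factorial : ℂ)) =
        ∑ k ∈ Finset.range (m + 1), c i * lam i ^ k * ((t : ℂ) ^ k / (k.factorial : ℂ)) := by
      intro i _
      rw [mul_sub, sub_sub_cancel, Finset.mul_sum]
      exact Finset.sum_congr rfl fun k _ => by rw [mul_pow]; ring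
    rw [Finset.sum_congr rfl this, Finset.sum_comm, Finset.sum_range_succ,
      Finset.sum_eq_zero, zero_add, ← Finset.sum_mul, ← hμ]
    · ring
    · intro k hk
      have hk := Finset.mem_range.1 hk
      rw [← Finset.sum_mul, ih k hk (hk.trans hm), zero_mul]
  obtain ⟨B, hB⟩ := heq.bound
  have hle : ∀ᶠ t : ℝ in 𝓝[<] 0, ‖μ / (m.factorial : ℂ)‖ ≤ B * ‖(t : ℂ)‖ := by
    filter_upwards [hB, self_mem_nhdsWithin] with t ht ht0
    have hp : 0 < ‖(t : ℂ) ^ m‖ := by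
      rw [norm_pos_iff]; exact pow_ne_zero _ (by exact_mod_cast ht0.ne)
    rw [norm_mul, pow_succ, norm_mul] at ht
    exact le_of_mul_le_mul_right (by linarith) hp
  have h0 : Tendsto (fun t : ℝ => B * ‖(t : ℂ)‖) (𝓝[<] 0) (𝓝 0) := by
    simpa using hlim.norm.const_mul B
  have := ge_of_tendsto h0 hle
  have hz : μ / (m.factorial : ℂ) = 0 := norm_le_zero_iff.1 this
  simpa [Nat.factorial_ne_zero] using hz

/-- All complex roots of `p` are positive real numbers; in particular `p ≠ 0`. -/
def HasPosRoots (p : ℂ[X]) : Prop := ∀ z : ℂ, p.eval z = 0 → z.im = 0 ∧ 0 < z.re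

theorem HasPosRoots.ne_zero {p : ℂ[X]} (hp : HasPosRoots p) : p ≠ 0 := by
  rintro rfl
  have := (hp 0 (by simp)).2
  simp at this

theorem HasPosRoots.im_sum_ne_zero_or {p : ℂ[X]} (hp : HasPosRoots p) {z : ℂ}
    (hz : ¬ (z.im = 0 ∧ 0 < z.re)) :
    ((p.roots.map fun r => r / (z - r)).sum).im ≠ 0 ∨
      (-(p.natDegree : ℝ) ≤ ((p.roots.map fun r => r / (z - r)).sum).re ∧
        ((p.roots.map fun r => r / (z - r)).sum).re ≤ 0) := by
  have hr : ∀ r ∈ p.roots, r.im = 0 ∧ 0 < r.re := fun r h => hp r (isRoot_of_mem_roots h)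
  rw [← splits_iff_card_roots.1 (IsAlgClosed.splits p)]
  generalize p.roots = S at hr
  have hne : ∀ r : ℂ, r.im = 0 ∧ 0 < r.re → z - r ≠ 0 := by
    intro r h h0
    exact hz (sub_eq_zero.1 h0 ▸ h)
  by_cases him : z.im = 0
  · right
    have hre : z.re ≤ 0 := not_lt.1 fun h => hz ⟨him, h⟩
    induction S using Multiset.induction_on with
    | empty => simp
    | cons r S ih =>
      obtain ⟨h1, h2⟩ := ih fun r h => hr r (Multiset.mem_cons_of_mem h)
      obtain ⟨hi, hp⟩ := hr r (Multiset.mem_cons_self r S)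
      have hrr : r / (z - r) = ((r.re / (z.re - r.re) : ℝ) : ℂ) := by
        push_cast
        congr 1
        · apply Complex.ext <;> simp [hi]
        · apply Complex.ext <;> simp [hi, him]
      have hlt : z.re - r.re < 0 := by linarith
      have h3 : r.re / (z.re - r.re) ≤ 0 := div_nonpos_of_nonneg_of_nonpos hp.le hlt.le
      have h4 : -1 ≤ r.re / (z.re - r.re) := by
        rw [le_div_iff_of_neg hlt]; linarith
      simp only [Multiset.map_cons, Multiset.sum_cons, Complex.add_re, hrr, Complex.ofReal_re,
        Multiset.card_cons, Nat.cast_add, Nat.cast_one]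
      constructor <;> linarith
  · suffices h : S = 0 ∨ z.im * ((S.map fun r => r / (z - r)).sum).im < 0 by
      rcases h with rfl | h
      · right; simp
      · left; intro h0; rw [h0] at h; simp at h
    induction S using Multiset.induction_on with
    | empty => left; rfl
    | cons r S ih =>
      right
      obtain ⟨hi, hp⟩ := hr r (Multiset.mem_cons_self r S)
      have h1 : z.im * (r / (z - r)).im < 0 := by
        have hN : 0 < Complex.normSq (z - r) := Complex.normSq_pos.2 (hne r ⟨hi, hp⟩)
        have : z.im * (r / (z - r)).im = -(r.re * z.im ^ 2 / Complex.normSq (z - r)) := by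
          rw [Complex.div_im]
          simp only [Complex.sub_im, Complex.sub_re, hi]
          ring
        rw [this, neg_lt_zero]
        have := sq_pos_of_ne_zero him
        positivity
      have h2 : z.im * ((S.map fun r => r / (z - r)).sum).im ≤ 0 := by
        rcases ih fun r h => hr r (Multiset.mem_cons_of_mem h) with rfl | h
        · simp
        · exact h.le
      rw [Multiset.map_cons, Multiset.sum_cons, Complex.add_im, mul_add]
      linarith

theorem HasPosRoots.mul_eval_derivative {p : ℂ[X]} (hp : HasPosRoots p) {z : ℂ}
    (hz : ¬ (z.im = 0 ∧ 0 < z.re)) :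
    z * p.derivative.eval z =
      p.eval z * (p.natDegree + (p.roots.map fun r => r / (z - r)).sum) := by
  have h0 : p.eval z ≠ 0 := fun h => hz (hp z h)
  rw [(IsAlgClosed.splits p).eval_derivative_eq_eval_mul_sum h0,
    splits_iff_card_roots.1 (IsAlgClosed.splits p) |>.symm, mul_left_comm]
  congr 1
  rw [← Multiset.sum_map_mul_left]
  have : ∀ r ∈ p.roots, z * (1 / (z - r)) = 1 + r / (z - r) := by
    intro r hr
    have : z - r ≠ 0 := fun h => h0 (sub_eq_zero.1 h ▸ isRoot_of_mem_roots hr)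
    field_simp
    ring
  rw [Multiset.map_congr rfl this, Multiset.sum_map_add]
  simp

theorem HasPosRoots.C_mul_add_X_mul_derivative {p : ℂ[X]} (hp : HasPosRoots p) {c : ℝ} (hc : 0 < c) :
    HasPosRoots (C (c : ℂ) * p + X * derivative p) := by
  intro z hz
  by_contra hcon
  have h0 : p.eval z ≠ 0 := fun h => hcon (hp z h)
  simp only [eval_add, eval_mul, eval_C, eval_X] at hz
  rw [hp.mul_eval_derivative hcon] at hz
  have hW : (p.roots.map fun r => r / (z - r)).sum = ((-c - p.natDegree : ℝ) : ℂ) := by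
    apply mul_left_cancel₀ h0
    push_cast
    linear_combination hz
  rcases hp.im_sum_ne_zero_or hcon with h | h
  · exact h (by rw [hW, Complex.ofReal_im])
  · rw [hW, Complex.ofReal_re] at h
    linarith [h.1]

theorem HasPosRoots.C_mul_sub_X_mul_derivative {p : ℂ[X]} (hp : HasPosRoots p) {d : ℝ} (hd : 0 < d) :
    HasPosRoots (C (d + p.natDegree : ℂ) * p - X * derivative p) := by
  intro z hz
  by_contra hcon
  have h0 : p.eval z ≠ 0 := fun h => hcon (hp z h)
  simp only [eval_sub, eval_mul, eval_C, eval_X] at hz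
  rw [hp.mul_eval_derivative hcon] at hz
  have hW : (p.roots.map fun r => r / (z - r)).sum = (d : ℂ) := by
    apply mul_left_cancel₀ h0
    linear_combination -hz
  rcases hp.im_sum_ne_zero_or hcon with h | h
  · exact h (by rw [hW, Complex.ofReal_im])
  · rw [hW, Complex.ofReal_re] at h
    linarith [h.2]

theorem coeff_X_mul_derivative (p : ℂ[X]) (k : ℕ) : (X * derivative p).coeff k = k * p.coeff k := by
  cases k with
  | zero => simp
  | succ k => rw [coeff_X_mul, coeff_derivative]; push_cast; ring

theorem natDegree_eq_of_coeff_eq_mul {p q : ℂ[X]} (hp : p ≠ 0) (w : ℕ → ℂ)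
    (h : ∀ k, q.coeff k = w k * p.coeff k) (hw : w p.natDegree ≠ 0) :
    q.natDegree = p.natDegree := by
  apply natDegree_eq_of_le_of_coeff_ne_zero
  · rw [natDegree_le_iff_coeff_eq_zero]
    intro k hk
    rw [h, coeff_eq_zero_of_natDegree_lt hk, mul_zero]
  · rw [h]
    exact mul_ne_zero hw (by simpa using hp)

theorem HasPosRoots.exists_coeff_eq_mul {p : ℂ[X]} (hp : HasPosRoots p) {c d : ℝ} (hc : 0 < c)
    (hd : 0 < d) : ∃ q : ℂ[X], HasPosRoots q ∧ q.natDegree = p.natDegree ∧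
      ∀ k, q.coeff k = (c + k) * (d + (p.natDegree - k)) * p.coeff k := by
  set p₁ := C (c : ℂ) * p + X * derivative p with hp₁
  have h₁ : HasPosRoots p₁ := hp.C_mul_add_X_mul_derivative hc
  have hc₁ : ∀ k, p₁.coeff k = (c + k) * p.coeff k := fun k => by
    rw [hp₁, coeff_add, coeff_C_mul, coeff_X_mul_derivative]; ring
  have hd₁ : p₁.natDegree = p.natDegree := by
    refine natDegree_eq_of_coeff_eq_mul hp.ne_zero _ hc₁ ?_
    have : (0 : ℝ) < c + p.natDegree := by positivity
    exact_mod_cast this.ne'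
  have hc₂ : ∀ k, (C (d + p₁.natDegree : ℂ) * p₁ - X * derivative p₁).coeff k =
      (d + (p.natDegree - k)) * p₁.coeff k := fun k => by
    rw [coeff_sub, coeff_C_mul, coeff_X_mul_derivative, hd₁]; ring
  refine ⟨_, h₁.C_mul_sub_X_mul_derivative hd, ?_, fun k => ?_⟩
  · rw [← hd₁]
    refine natDegree_eq_of_coeff_eq_mul h₁.ne_zero _ hc₂ ?_
    rw [hd₁, sub_self, add_zero]
    exact_mod_cast hd.ne'
  · rw [hc₂, hc₁]; ring

/-- The rising factorial `(b + 1) (b + 2) ⋯ (b + k)`. -/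
def shiftedRising (b : ℂ) (k : ℕ) : ℂ := ∏ m ∈ Finset.range k, (m + 1 + b)

theorem shiftedRising_ne_zero {b : ℝ} (hb : -1 < b) (k : ℕ) : shiftedRising b k ≠ 0 := by
  refine Finset.prod_ne_zero_iff.2 fun m _ => ?_
  have : (0 : ℝ) < m + 1 + b := by
    have : (0 : ℝ) ≤ m := Nat.cast_nonneg m
    linarith
  exact_mod_cast this.ne'

theorem shiftedRising_add_mul (b : ℂ) (k M : ℕ) :
    shiftedRising (b + k) M * shiftedRising b k =
      shiftedRising b M * ∏ m ∈ Finset.range k, ((M : ℂ) + m + 1 + b) := by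
  have h1 : shiftedRising b (M + k) =
      shiftedRising b M * ∏ m ∈ Finset.range k, ((M : ℂ) + m + 1 + b) := by
    rw [shiftedRising, Finset.prod_range_add]; push_cast; rfl
  have h2 : shiftedRising b (k + M) = shiftedRising b k * shiftedRising (b + k) M := by
    rw [shiftedRising, Finset.prod_range_add, shiftedRising, shiftedRising]
    congr 1
    exact Finset.prod_congr rfl fun m _ => by push_cast; ring
  rw [← h1, add_comm M k, h2, mul_comm]

theorem tendsto_shiftedRising_div {b : ℝ} (hb : -1 < b) (k : ℕ) :
    Tendsto (fun M : ℕ => shiftedRising (b + k) M / (shiftedRising b M * (M : ℂ) ^ k)) atTop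
      (𝓝 (shiftedRising b k)⁻¹) := by
  have h1 : Tendsto (fun M : ℕ => (∏ m ∈ Finset.range k, (1 + (m + 1 + (b : ℂ)) / M)) *
      (shiftedRising b k)⁻¹) atTop (𝓝 ((∏ m ∈ Finset.range k, (1 + 0)) *
      (shiftedRising b k)⁻¹)) := by
    refine Tendsto.mul_const _ (tendsto_finsetProd _ fun m _ => ?_)
    exact (tendsto_const_div_atTop_nhds_zero_nat (𝕜 := ℂ) _).const_add 1
  simp only [add_zero, Finset.prod_const_one, one_mul] at h1
  refine h1.congr' ?_
  filter_upwards [eventually_ne_atTop 0] with M hM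
  have hM' : (M : ℂ) ≠ 0 := by exact_mod_cast hM
  have e1 : ∏ m ∈ Finset.range k, ((M : ℂ) + m + 1 + b) =
      (M : ℂ) ^ k * ∏ m ∈ Finset.range k, (1 + (m + 1 + (b : ℂ)) / M) := by
    rw [← Finset.card_range k, ← Finset.prod_const, Finset.card_range, ← Finset.prod_mul_distrib]
    refine Finset.prod_congr rfl fun m _ => ?_
    field_simp
    ring
  have h2 := shiftedRising_add_mul b k M
  rw [e1] at h2
  rw [eq_div_iff (mul_ne_zero (shiftedRising_ne_zero hb M) (pow_ne_zero _ hM')),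
    ← div_eq_mul_inv, div_mul_eq_mul_div, div_eq_iff (shiftedRising_ne_zero hb k)]
  linear_combination -h2

theorem HasPosRoots.exists_coeff_eq_shiftedRising_mul {p : ℂ[X]} (hp : HasPosRoots p) {b : ℝ}
    (hb : -1 < b) (hb' : b < 1) (M : ℕ) :
    ∃ q : ℂ[X], HasPosRoots q ∧ q.natDegree = p.natDegree ∧ ∀ k ≤ p.natDegree,
      q.coeff k = shiftedRising (b + k) M *
        shiftedRising ((-b : ℝ) + (p.natDegree - k : ℕ)) M * p.coeff k := by
  induction M with
  | zero => exact ⟨p, hp, rfl, fun k _ => by simp [shiftedRising]⟩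
  | succ M ih =>
    obtain ⟨q, hq, hqd, hqc⟩ := ih
    have hM : (0 : ℝ) ≤ M := Nat.cast_nonneg M
    obtain ⟨r, hr, hrd, hrc⟩ := hq.exists_coeff_eq_mul (c := M + 1 + b) (d := M + 1 - b)
      (by linarith) (by linarith)
    refine ⟨r, hr, hrd.trans hqd, fun k hk => ?_⟩
    rw [hrc, hqc k hk, hqd]
    simp only [shiftedRising, Finset.prod_range_succ]
    push_cast [Nat.cast_sub hk]
    ring

theorem exists_pos_le_norm_sub {z : ℂ} (hz : ¬ (z.im = 0 ∧ 0 ≤ z.re)) :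
    ∃ d : ℝ, 0 < d ∧ ∀ r : ℂ, r.im = 0 ∧ 0 < r.re → d ≤ ‖z - r‖ := by
  by_cases him : z.im = 0
  · refine ⟨-z.re, by by_contra h; exact hz ⟨him, by linarith⟩, fun r hr => ?_⟩
    have := Complex.abs_re_le_norm (z - r)
    have h2 := neg_le_abs (z - r).re
    rw [Complex.sub_re] at h2 this
    linarith [hr.2]
  · refine ⟨|z.im|, abs_pos.2 him, fun r hr => ?_⟩
    have := Complex.abs_im_le_norm (z - r)
    rwa [Complex.sub_im, hr.1, sub_zero] at this

theorem HasPosRoots.le_norm_eval {p : ℂ[X]} (hp : HasPosRoots p) {z : ℂ} {d : ℝ} (hd : 0 < d)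
    (h : ∀ r : ℂ, r.im = 0 ∧ 0 < r.re → d ≤ ‖z - r‖) :
    ‖p.coeff p.natDegree‖ * d ^ p.natDegree ≤ ‖p.eval z‖ := by
  have hs := IsAlgClosed.splits p
  rw [hs.eval_eq_prod_roots, norm_mul, coeff_natDegree, ← splits_iff_card_roots.1 hs]
  refine mul_le_mul_of_nonneg_left ?_ (norm_nonneg _)
  have hr : ∀ r ∈ p.roots, r.im = 0 ∧ 0 < r.re := fun r h => hp r (isRoot_of_mem_roots h)
  generalize p.roots = S at hr
  induction S using Multiset.induction_on with
  | empty => simp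
  | cons r S ih =>
    have h1 := ih fun r h => hr r (Multiset.mem_cons_of_mem h)
    have h2 := h r (hr r (Multiset.mem_cons_self r S))
    rw [Multiset.card_cons, pow_succ', Multiset.map_cons, Multiset.prod_cons, norm_mul]
    exact mul_le_mul h2 h1 (by positivity) (norm_nonneg _)

theorem HasPosRoots.of_tendsto_coeff {n : ℕ} {q : ℂ[X]} (hq : q.natDegree = n)
    (hq0 : q.coeff 0 ≠ 0) (p : ℕ → ℂ[X]) (w : ℕ → ℂ) (hp : ∀ M, HasPosRoots (p M))
    (hn : ∀ M, (p M).natDegree = n)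
    (hlim : ∀ k ≤ n, Tendsto (fun M => (p M).coeff k / w M) atTop (𝓝 (q.coeff k))) :
    HasPosRoots q := by
  intro z hz
  by_contra hcon
  have hz0 : z ≠ 0 := by
    rintro rfl
    exact hq0 (by rwa [coeff_zero_eq_eval_zero])
  have hcon' : ¬ (z.im = 0 ∧ 0 ≤ z.re) := fun h => hcon ⟨h.1, lt_of_le_of_ne h.2 fun h' =>
    hz0 (Complex.ext h'.symm h.1)⟩
  obtain ⟨d, hd, hdz⟩ := exists_pos_le_norm_sub hcon'
  have h1 : Tendsto (fun M => (p M).eval z / w M) atTop (𝓝 (q.eval z)) := by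
    rw [eval_eq_sum_range, hq]
    simp_rw [eval_eq_sum_range, hn, Finset.sum_div]
    refine tendsto_finsetSum _ fun k hk => ?_
    refine ((hlim k (by simpa [Nat.lt_succ_iff] using hk)).mul_const (z ^ k)).congr fun M => ?_
    ring
  have h2 := ((hlim n le_rfl).norm).mul_const (d ^ n)
  have h3 := le_of_tendsto_of_tendsto h2 h1.norm (Eventually.of_forall fun M => by
    have := (hp M).le_norm_eval hd hdz
    rw [hn] at this
    simp only [norm_div]
    rw [div_mul_eq_mul_div]
    exact div_le_div_of_nonneg_right this (norm_nonneg _))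
  rw [hz, norm_zero] at h3
  have hlead : q.coeff n ≠ 0 := by
    rw [← hq, coeff_natDegree, leadingCoeff_ne_zero]
    rintro rfl
    simp at hq0
  have : 0 < ‖q.coeff n‖ * d ^ n := by positivity
  linarith

theorem HasPosRoots.of_shiftedRising_mul_coeff {p q : ℂ[X]} (hp : HasPosRoots p) {b : ℝ}
    (hb : -1 < b) (hb' : b < 1) (hq : q.natDegree ≤ p.natDegree)
    (h : ∀ k ≤ p.natDegree, shiftedRising b k *
      shiftedRising (-b : ℝ) (p.natDegree - k) * q.coeff k = p.coeff k) :
    q.natDegree = p.natDegree ∧ HasPosRoots q := by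
  have hd : q.natDegree = p.natDegree := by
    refine natDegree_eq_of_le_of_coeff_ne_zero hq fun h0 => hp.ne_zero ?_
    have := h _ le_rfl
    rw [h0, mul_zero] at this
    exact leadingCoeff_eq_zero.1 this.symm
  refine ⟨hd, ?_⟩
  choose r hr hrd hrc using hp.exists_coeff_eq_shiftedRising_mul hb hb'
  refine HasPosRoots.of_tendsto_coeff hd ?_ r (fun M => shiftedRising b M *
    shiftedRising (-b : ℝ) M * (M : ℂ) ^ p.natDegree) hr hrd fun k hk => ?_
  · intro h0
    have := h 0 (Nat.zero_le _)
    rw [h0, mul_zero, coeff_zero_eq_eval_zero] at this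
    simpa using hp 0 this.symm
  · have h1 := ((tendsto_shiftedRising_div hb k).mul (tendsto_shiftedRising_div
      (neg_lt_neg hb') (p.natDegree - k))).mul_const (p.coeff k)
    have hb0 := shiftedRising_ne_zero hb k
    have hb1 := shiftedRising_ne_zero (neg_lt_neg hb') (p.natDegree - k)
    have e : (shiftedRising b k)⁻¹ * (shiftedRising (-b : ℝ) (p.natDegree - k))⁻¹ * p.coeff k =
        q.coeff k := by
      rw [← h k hk]
      field_simp
    rw [e] at h1
    refine h1.congr fun M => ?_
    rw [hrc M k hk]
    have : (M : ℂ) ^ p.natDegree = (M : ℂ) ^ k * (M : ℂ) ^ (p.natDegree - k) := by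
      rw [← pow_add]; congr 1; omega
    rw [this, div_mul_div_comm, div_mul_eq_mul_div]
    congr 1
    ring

theorem eval_eq_exp_of_branch {α : ℝ} {f : ℂ → ℂ}
    (hf : DifferentiableOn ℂ f {z : ℂ | ¬(z.im = 0 ∧ -1 ≤ z.re ∧ z.re ≤ 1)})
    (hf1 : Tendsto f (Bornology.cobounded ℂ) (𝓝 1))
    (hbranch : ∀ z : ℂ, ¬(z.im = 0 ∧ -1 ≤ z.re ∧ z.re ≤ 1) →
      (z ^ 2 - 1) * deriv f z = 2 * (α : ℂ) * f z)
    (htop : Tendsto (fun s : ℝ => (1 + Real.exp s) / (1 - Real.exp s)) (𝓝[<] 0) atTop)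
    {s : ℝ} (hs : s < 0) :
    f (((1 + Real.exp s) / (1 - Real.exp s) : ℝ) : ℂ) = Complex.exp (α * s) := by
  set u : ℝ → ℝ := fun s => (1 + Real.exp s) / (1 - Real.exp s) with hu
  have hopen : IsOpen {z : ℂ | ¬(z.im = 0 ∧ -1 ≤ z.re ∧ z.re ≤ 1)} := by
    have h1 : IsClosed {z : ℂ | z.im = 0} := isClosed_eq Complex.continuous_im continuous_const
    have h2 : IsClosed {z : ℂ | -1 ≤ z.re} := isClosed_le continuous_const Complex.continuous_re
    have h3 : IsClosed {z : ℂ | z.re ≤ 1} := isClosed_le Complex.continuous_re continuous_const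
    exact (h1.inter (h2.inter h3)).isOpen_compl
  have hmem : ∀ t < 0, ¬(((u t : ℝ) : ℂ).im = 0 ∧ -1 ≤ ((u t : ℝ) : ℂ).re ∧
      ((u t : ℝ) : ℂ).re ≤ 1) := by
    rintro t ht ⟨-, -, h⟩
    have h1 : Real.exp t < 1 := Real.exp_lt_one_iff.2 ht
    rw [Complex.ofReal_re, hu, div_le_one (by linarith)] at h
    linarith [Real.exp_pos t]
  have hder : ∀ t < 0, HasDerivAt (fun t : ℝ => f (u t) * Complex.exp (-(α * t))) 0 t := by
    intro t ht
    have h1 : 1 - Real.exp t ≠ 0 := by linarith [Real.exp_lt_one_iff.2 ht]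
    have h1' : (1 - (Real.exp t : ℂ)) ≠ 0 := by exact_mod_cast h1
    have hu' : HasDerivAt u ((Real.exp t * (1 - Real.exp t) -
        (1 + Real.exp t) * (-Real.exp t)) / (1 - Real.exp t) ^ 2) t :=
      ((Real.hasDerivAt_exp t).const_add 1).div ((Real.hasDerivAt_exp t).const_sub 1) h1
    have hf' : HasDerivAt f (deriv f (u t)) (u t) :=
      (hf.differentiableAt (hopen.mem_nhds (hmem t ht))).hasDerivAt
    have hcomp := HasDerivAt.scomp t hf' hu'.ofReal_comp
    have hexp : HasDerivAt (fun t : ℝ => Complex.exp (-(α * t)))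
        (Complex.exp (-(α * t)) * (-(α * 1))) t :=
      (((hasDerivAt_id (t : ℂ)).const_mul (α : ℂ)).neg.cexp).comp_ofReal
    refine (hcomp.mul hexp).congr_deriv ?_
    have hb := hbranch _ (hmem t ht)
    have hut : ((u t : ℝ) : ℂ) = (1 + (Real.exp t : ℂ)) / (1 - Real.exp t) := by
      rw [hu]; push_cast; rfl
    have hd : ((((Real.exp t * (1 - Real.exp t) -
        (1 + Real.exp t) * (-Real.exp t)) / (1 - Real.exp t) ^ 2 : ℝ)) : ℂ) =
        (((u t : ℝ) : ℂ) ^ 2 - 1) / 2 := by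
      rw [hut]
      push_cast at h1' ⊢
      field_simp
      ring
    simp only [Function.comp_apply, smul_eq_mul]
    rw [hd]
    linear_combination (Complex.exp (-(α * t)) / 2) * hb
  obtain ⟨a, ha⟩ := (isOpen_Iio (a := (0 : ℝ))).exists_is_const_of_deriv_eq_zero
    isPreconnected_Iio (fun t ht => (hder t ht).differentiableAt.differentiableWithinAt)
    (fun t ht => (hder t ht).deriv)
  have hcob : Tendsto (fun t : ℝ => ((u t : ℝ) : ℂ)) (𝓝[<] 0) (Bornology.cobounded ℂ) := by
    rw [← tendsto_norm_atTop_iff_cobounded]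
    simp only [Complex.norm_real, Real.norm_eq_abs]
    exact tendsto_abs_atTop_atTop.comp htop
  have hexp0 : Tendsto (fun t : ℝ => Complex.exp (-(α * t))) (𝓝[<] 0) (𝓝 1) := by
    have : Continuous fun t : ℝ => Complex.exp (-(α * t)) := by fun_prop
    simpa using (this.tendsto 0).mono_left nhdsWithin_le_nhds
  have hlim : Tendsto (fun t : ℝ => f (u t) * Complex.exp (-(α * t))) (𝓝[<] 0) (𝓝 (1 * 1)) :=
    (hf1.comp hcob).mul hexp0
  have ha1 : a = 1 := by
    rw [mul_one] at hlim
    refine tendsto_nhds_unique (tendsto_const_nhds.congr' ?_) hlim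
    filter_upwards [self_mem_nhdsWithin] with t ht
    exact (ha t ht).symm
  have := ha s hs
  rw [ha1, Complex.exp_neg] at this
  exact eq_of_mul_inv_eq_one this

theorem tendsto_one_add_exp_div_one_sub_exp :
    Tendsto (fun s : ℝ => (1 + Real.exp s) / (1 - Real.exp s)) (𝓝[<] 0) atTop := by
  have h1 : Tendsto (fun s : ℝ => 1 + Real.exp s) (𝓝[<] 0) (𝓝 2) := by
    have : Continuous fun s : ℝ => 1 + Real.exp s := by fun_prop
    have h := (this.tendsto 0).mono_left (nhdsWithin_le_nhds (s := Set.Iio 0))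
    norm_num at h
    exact h
  have h2 : Tendsto (fun s : ℝ => 1 - Real.exp s) (𝓝[<] 0) (𝓝[>] 0) := by
    refine tendsto_nhdsWithin_iff.2 ⟨?_, ?_⟩
    · have : Continuous fun s : ℝ => 1 - Real.exp s := by fun_prop
      simpa using (this.tendsto 0).mono_left (nhdsWithin_le_nhds (s := Set.Iio 0))
    · filter_upwards [self_mem_nhdsWithin] with s hs
      exact sub_pos.2 (Real.exp_lt_one_iff.2 hs)
  simp_rw [div_eq_mul_inv]
  exact h1.pos_mul_atTop (by norm_num) (tendsto_inv_nhdsGT_zero.comp h2)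

/-- The polynomial `(1 - x) ^ n * Q ((1 + x) / (1 - x))`. -/
noncomputable def cayleyTransform (n : ℕ) (Q : ℂ[X]) : ℂ[X] :=
  ∑ k ∈ Finset.range (n + 1), C (Q.coeff k) * ((1 + X) ^ k * (1 - X) ^ (n - k))

theorem natDegree_one_add_X_le : (1 + X : ℂ[X]).natDegree ≤ 1 :=
  (natDegree_add_le _ _).trans (by simp)

theorem natDegree_one_sub_X_le : (1 - X : ℂ[X]).natDegree ≤ 1 :=
  (natDegree_sub_le _ _).trans (by simp)

theorem natDegree_cayleyTransform_le (n : ℕ) (Q : ℂ[X]) : (cayleyTransform n Q).natDegree ≤ n := by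
  refine natDegree_sum_le_of_forall_le _ _ fun k hk => ?_
  have hk : k ≤ n := by simpa [Nat.lt_succ_iff] using hk
  refine (natDegree_C_mul_le _ _).trans (natDegree_mul_le.trans ?_)
  have h1 := natDegree_pow_le_of_le k natDegree_one_add_X_le
  have h2 := natDegree_pow_le_of_le (n - k) natDegree_one_sub_X_le
  omega

theorem eval_cayleyTransform {n : ℕ} {Q : ℂ[X]} (hQ : Q.natDegree ≤ n) {x : ℂ} (hx : 1 - x ≠ 0) :
    (cayleyTransform n Q).eval x = (1 - x) ^ n * Q.eval ((1 + x) / (1 - x)) := by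
  rw [eval_eq_sum_range' (Nat.lt_succ_of_le hQ), cayleyTransform, eval_finsetSum, Finset.mul_sum]
  refine Finset.sum_congr rfl fun k hk => ?_
  have hk : k ≤ n := by simpa [Nat.lt_succ_iff] using hk
  simp only [eval_mul, eval_C, eval_pow, eval_add, eval_sub, eval_one, eval_X]
  rw [div_pow, ← pow_sub_mul_pow (1 - x) hk]
  field_simp

theorem coeff_cayleyTransform {n : ℕ} {Q : ℂ[X]} (hQ : Q.natDegree ≤ n) :
    (cayleyTransform n Q).coeff n = (-1) ^ n * Q.eval (-1) := by
  rw [eval_eq_sum_range' (Nat.lt_succ_of_le hQ), cayleyTransform, finsetSum_coeff, Finset.mul_sum]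
  refine Finset.sum_congr rfl fun k hk => ?_
  have hk : k ≤ n := by simpa [Nat.lt_succ_iff] using hk
  have h1 : ((1 + X : ℂ[X]) ^ k).natDegree ≤ k := by
    simpa using natDegree_pow_le_of_le k natDegree_one_add_X_le
  have h2 : ((1 - X : ℂ[X]) ^ (n - k)).natDegree ≤ n - k := by
    simpa using natDegree_pow_le_of_le (n - k) natDegree_one_sub_X_le
  have h3 := coeff_mul_add_eq_of_natDegree_le h1 h2
  have h4 := coeff_pow_of_natDegree_le (m := k) natDegree_one_add_X_le
  have h5 := coeff_pow_of_natDegree_le (m := n - k) natDegree_one_sub_X_le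
  rw [mul_one] at h4 h5
  rw [Nat.add_sub_cancel' hk, h4, h5] at h3
  rw [coeff_C_mul, h3]
  have h6 : ((-1 : ℂ)) ^ n = (-1) ^ (n - k) * (-1) ^ k := by rw [pow_sub_mul_pow _ hk]
  have h7 : ((-1 : ℂ)) ^ k * (-1) ^ k = 1 := by rw [← mul_pow]; simp
  simp only [coeff_add, coeff_sub, coeff_one, coeff_X_one]
  norm_num
  rw [h6]
  linear_combination (-Q.coeff k * (-1) ^ (n - k)) * h7

theorem eq_zero_of_cayleyTransform_eq_zero {n : ℕ} {Q : ℂ[X]} (hQ : Q.natDegree ≤ n)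
    (h : cayleyTransform n Q = 0) : Q = 0 := by
  have hz : ∀ z : ℂ, z ≠ -1 → Q.eval z = 0 := by
    intro z hz
    have hz' : z + 1 ≠ 0 := fun h => hz (eq_neg_of_add_eq_zero_left h)
    have h1 : 1 - (z - 1) / (z + 1) = 2 / (z + 1) := by field_simp; ring
    have h2 : (1 + (z - 1) / (z + 1)) / (1 - (z - 1) / (z + 1)) = z := by
      rw [h1]; field_simp; ring
    have h3 : 1 - (z - 1) / (z + 1) ≠ 0 := by rw [h1]; exact div_ne_zero two_ne_zero hz'
    have := eval_cayleyTransform hQ h3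
    rw [h, h2, eval_zero] at this
    exact (mul_eq_zero.1 this.symm).resolve_left (pow_ne_zero _ h3)
  refine eq_zero_of_infinite_isRoot Q ((Set.finite_singleton (-1 : ℂ)).infinite_compl.mono ?_)
  exact fun z h => hz z h

theorem isRoot_real_of_hasPosRoots_cayleyTransform {n : ℕ} {Q : ℂ[X]} (hQ : Q.natDegree ≤ n)
    (hP : HasPosRoots (cayleyTransform n Q)) (hd : (cayleyTransform n Q).natDegree = n) {z : ℂ}
    (hz : Q.IsRoot z) : z.im = 0 ∧ (z.re < -1 ∨ 1 < z.re) := by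
  have hne : z ≠ -1 := by
    rintro rfl
    have h1 := coeff_cayleyTransform hQ
    rw [hz.eq_zero, mul_zero] at h1
    apply hP.ne_zero
    rw [← leadingCoeff_eq_zero, leadingCoeff, hd, h1]
  have hz' : z + 1 ≠ 0 := fun h => hne (eq_neg_of_add_eq_zero_left h)
  have h1 : 1 - (z - 1) / (z + 1) = 2 / (z + 1) := by field_simp; ring
  have h2 : (1 + (z - 1) / (z + 1)) / (1 - (z - 1) / (z + 1)) = z := by
    rw [h1]; field_simp; ring
  have h3 : 1 - (z - 1) / (z + 1) ≠ 0 := by rw [h1]; exact div_ne_zero two_ne_zero hz'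
  have h4 := eval_cayleyTransform hQ h3
  rw [h2, hz.eq_zero, mul_zero] at h4
  obtain ⟨him, hre⟩ := hP _ h4
  set x := (z - 1) / (z + 1) with hx
  have hxr : x = (x.re : ℂ) := Complex.ext rfl (by simp [him])
  have hx1 : 1 - x.re ≠ 0 := by
    intro h; apply h3; rw [hxr]; exact_mod_cast h
  have hzr : z = (((1 + x.re) / (1 - x.re) : ℝ) : ℂ) := by
    rw [← h2, hxr]; push_cast; rfl
  rw [hzr, Complex.ofReal_im, Complex.ofReal_re]
  refine ⟨rfl, ?_⟩
  rcases lt_or_gt_of_ne hx1 with h | h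
  · left; rw [div_lt_iff_of_neg h]; linarith
  · right; rw [lt_div_iff₀ h]; linarith

theorem prod_erase_range {n k : ℕ} (hk : k ≤ n) (g : ℕ → ℂ) :
    ∏ l ∈ (Finset.range (n + 1)).erase k, g l =
      (∏ l ∈ Finset.range k, g l) * ∏ m ∈ Finset.range (n - k), g (k + 1 + m) := by
  have hmem : k ∈ Finset.range (n + 1) := Finset.mem_range.2 (Nat.lt_succ_of_le hk)
  have h := Finset.prod_update_of_mem hmem g 1
  rw [one_mul, Finset.sdiff_singleton_eq_erase] at h
  rw [← h, show n + 1 = k + 1 + (n - k) by omega, Finset.prod_range_add, Finset.prod_range_succ]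
  simp only [Function.update_self, mul_one]
  congr 1
  · refine Finset.prod_congr rfl fun l hl => Function.update_of_ne ?_ _ _
    exact (Finset.mem_range.1 hl).ne
  · refine Finset.prod_congr rfl fun l _ => Function.update_of_ne ?_ _ _
    omega

theorem prod_erase_range_sub {n k : ℕ} (hk : k ≤ n) (b : ℝ) :
    ∏ l ∈ (Finset.range (n + 1)).erase k, ((b : ℂ) + k - l) =
      shiftedRising b k * ((-1) ^ (n - k) * shiftedRising (-b : ℝ) (n - k)) := by
  rw [prod_erase_range hk]
  congr 1
  · rw [shiftedRising, ← Finset.prod_range_reflect]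
    refine Finset.prod_congr rfl fun l hl => ?_
    have hl := Finset.mem_range.1 hl
    rw [show k - 1 - l = k - (1 + l) by omega, Nat.cast_sub (by omega)]
    push_cast
    ring
  · rw [shiftedRising]
    nth_rewrite 2 [← Finset.card_range (n - k)]
    rw [← Finset.prod_const, ← Finset.prod_mul_distrib]
    refine Finset.prod_congr rfl fun l _ => ?_
    push_cast
    ring

theorem prod_erase_exponents {α : ℝ} {n k : ℕ} (hk : k ≤ n) (j : Fin 3) :
    ∏ p ∈ ((Finset.univ : Finset (Fin 3)) ×ˢ Finset.range (n + 1)).erase (j, k),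
      (((j : ℂ) * α + k) - ((p.1 : ℂ) * α + (p.2 : ℂ))) =
    ∏ i : Fin 3, ((if i = j then 1 else ((((j : ℝ) - i) * α : ℝ) : ℂ)) *
      (shiftedRising (((j : ℝ) - i) * α : ℝ) k *
        ((-1) ^ (n - k) * shiftedRising (-(((j : ℝ) - i) * α) : ℝ) (n - k)))) := by
  have hmem : (j, k) ∈ (Finset.univ : Finset (Fin 3)) ×ˢ Finset.range (n + 1) := by
    simp [hk]
  have h := Finset.prod_update_of_mem hmem
    (fun p => ((j : ℂ) * α + k) - ((p.1 : ℂ) * α + (p.2 : ℂ))) 1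
  rw [one_mul, Finset.sdiff_singleton_eq_erase] at h
  rw [← h, Finset.prod_product]
  refine Finset.prod_congr rfl fun i _ => ?_
  rw [← prod_erase_range_sub hk]
  have hmem' : k ∈ Finset.range (n + 1) := Finset.mem_range.2 (Nat.lt_succ_of_le hk)
  rw [← Finset.mul_prod_erase _ _ hmem']
  congr 1
  · split_ifs with hij
    · rw [hij, Function.update_self]
    · rw [Function.update_of_ne (by simp [hij])]
      push_cast
      ring
  · refine Finset.prod_congr rfl fun l hl => ?_
    rw [Function.update_of_ne (by simp [(Finset.mem_erase.1 hl).1])]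
    push_cast
    ring

theorem shiftedRising_zero (k : ℕ) : shiftedRising 0 k = (k.factorial : ℂ) := by
  induction k with
  | zero => simp [shiftedRising]
  | succ k ih =>
    rw [shiftedRising, Finset.prod_range_succ, ← shiftedRising, ih, Nat.factorial_succ]
    push_cast
    ring

theorem hasPosRoots_of_shiftedRising_mul_eq {P : ℂ[X]} {n : ℕ} (hP : P.natDegree ≤ n) {b₁ b₂ : ℝ}
    (h₁ : |b₁| < 1) (h₂ : |b₂| < 1) {κ : ℂ} (hκ : κ ≠ 0)
    (h : ∀ k ≤ n, shiftedRising b₁ k * shiftedRising (-b₁ : ℝ) (n - k) *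
      (shiftedRising b₂ k * shiftedRising (-b₂ : ℝ) (n - k)) *
      (shiftedRising 0 k * shiftedRising 0 (n - k)) * P.coeff k = (-1) ^ (n - k) * κ) :
    P.natDegree = n ∧ HasPosRoots P := by
  have hn : (n.factorial : ℂ) ≠ 0 := by exact_mod_cast n.factorial_ne_zero
  have hc : κ / n.factorial ≠ 0 := div_ne_zero hκ hn
  set p : ℂ[X] := C (κ / n.factorial) * (X + C (-1)) ^ n with hp
  have hpd : p.natDegree = n := by
    rw [hp, natDegree_C_mul hc, natDegree_pow, natDegree_X_add_C, mul_one]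
  have hpr : HasPosRoots p := by
    intro z hz
    rw [hp, eval_mul, eval_C, eval_pow, eval_add, eval_X, eval_C] at hz
    have : z + -1 = 0 := eq_zero_of_pow_eq_zero ((mul_eq_zero.1 hz).resolve_left hc)
    rw [← sub_eq_add_neg, sub_eq_zero] at this
    rw [this]
    simp
  set q : ℂ[X] := ∑ k ∈ Finset.range (n + 1), monomial k
    (shiftedRising b₂ k * shiftedRising (-b₂ : ℝ) (n - k) * P.coeff k) with hq
  have hqc : ∀ k ≤ n, q.coeff k =
      shiftedRising b₂ k * shiftedRising (-b₂ : ℝ) (n - k) * P.coeff k := by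
    intro k hk
    rw [hq, finsetSum_coeff]
    simp only [coeff_monomial]
    rw [Finset.sum_ite_eq' (Finset.range (n + 1)) k]
    rw [if_pos (Finset.mem_range.2 (Nat.lt_succ_of_le hk))]
  have hqd : q.natDegree ≤ n := natDegree_sum_le_of_forall_le _ _ fun k hk =>
    (natDegree_monomial_le _).trans (by simpa [Nat.lt_succ_iff] using hk)
  obtain ⟨hb₁, hb₁'⟩ := abs_lt.1 h₁
  obtain ⟨hb₂, hb₂'⟩ := abs_lt.1 h₂
  obtain ⟨hqd', hqr⟩ := hpr.of_shiftedRising_mul_coeff (q := q) hb₁ hb₁' (hqd.trans hpd.ge)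
    fun k hk => by
      rw [hpd] at hk ⊢
      rw [hqc k hk, hp, coeff_C_mul, coeff_X_add_C_pow]
      have e := h k hk
      rw [shiftedRising_zero, shiftedRising_zero] at e
      have hch : (n.choose k : ℂ) * k.factorial * (n - k).factorial = n.factorial := by
        exact_mod_cast Nat.choose_mul_factorial_mul_factorial hk
      have hfac : (k.factorial : ℂ) * (n - k).factorial ≠ 0 := by
        exact_mod_cast mul_ne_zero k.factorial_ne_zero (n - k).factorial_ne_zero
      apply mul_right_cancel₀ hfac
      field_simp
      linear_combination (n.factorial : ℂ) * e - κ * (-1) ^ (n - k) * hch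
  rw [hpd] at hqd'
  obtain ⟨h3, h4⟩ := hqr.of_shiftedRising_mul_coeff (q := P) hb₂ hb₂' (hP.trans hqd'.ge)
    fun k hk => by
      rw [hqd'] at hk ⊢
      rw [hqc k hk]
  exact ⟨h3.trans hqd', h4⟩

theorem exp_sum_eq_of_branch {α : ℝ} {f : ℂ → ℂ} {n : ℕ} {Q : Fin 3 → ℂ[X]}
    (hdeg : ∀ j, (Q j).natDegree ≤ n) {s : ℝ} (hs : s < 0)
    (hfs : f (((1 + Real.exp s) / (1 - Real.exp s) : ℝ) : ℂ) = Complex.exp (α * s)) :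
    ∑ p ∈ (Finset.univ : Finset (Fin 3)) ×ˢ Finset.range (n + 1),
      (cayleyTransform n (Q p.1)).coeff p.2 *
        Complex.exp (((p.1 : ℂ) * α + (p.2 : ℂ)) * s) =
      ((1 - Real.exp s : ℝ) : ℂ) ^ n *
        ((Q 0).eval (((1 + Real.exp s) / (1 - Real.exp s) : ℝ) : ℂ) +
          (Q 1).eval (((1 + Real.exp s) / (1 - Real.exp s) : ℝ) : ℂ) *
            f (((1 + Real.exp s) / (1 - Real.exp s) : ℝ) : ℂ) +
          (Q 2).eval (((1 + Real.exp s) / (1 - Real.exp s) : ℝ) : ℂ) *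
            f (((1 + Real.exp s) / (1 - Real.exp s) : ℝ) : ℂ) ^ 2) := by
  have h1 : (1 - (Real.exp s : ℂ)) ≠ 0 := by
    have : 1 - Real.exp s ≠ 0 := by linarith [Real.exp_lt_one_iff.2 hs]
    exact_mod_cast this
  have key : ∀ j : Fin 3, ∑ k ∈ Finset.range (n + 1), (cayleyTransform n (Q j)).coeff k *
      Complex.exp (((j : ℂ) * α + (k : ℂ)) * s) = ((1 - Real.exp s : ℝ) : ℂ) ^ n *
        (Q j).eval (((1 + Real.exp s) / (1 - Real.exp s) : ℝ) : ℂ) *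
          Complex.exp (α * s) ^ (j : ℕ) := by
    intro j
    have h2 := eval_cayleyTransform (hdeg j) h1
    rw [eval_eq_sum_range' (Nat.lt_succ_of_le (natDegree_cayleyTransform_le n (Q j)))] at h2
    push_cast at h2 ⊢
    rw [← h2, Finset.sum_mul]
    refine Finset.sum_congr rfl fun k _ => ?_
    rw [← Complex.exp_nat_mul, ← Complex.exp_nat_mul, mul_assoc, ← Complex.exp_add]
    congr 2
    ring
  rw [Finset.sum_product]
  simp only [key, hfs, Fin.sum_univ_three]
  simp
  ring

theorem eventually_norm_exp_sum_le {α : ℝ} {f : ℂ → ℂ}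
    (hf : DifferentiableOn ℂ f {z : ℂ | ¬(z.im = 0 ∧ -1 ≤ z.re ∧ z.re ≤ 1)})
    (hf1 : Tendsto f (Bornology.cobounded ℂ) (𝓝 1))
    (hbranch : ∀ z : ℂ, ¬(z.im = 0 ∧ -1 ≤ z.re ∧ z.re ≤ 1) →
      (z ^ 2 - 1) * deriv f z = 2 * (α : ℂ) * f z)
    {n : ℕ} {Q : Fin 3 → ℂ[X]} (hdeg : ∀ j, (Q j).natDegree ≤ n)
    (hrem : ∃ C R' : ℝ, ∀ z : ℂ, R' < ‖z‖ →
      ‖z ^ (2 * n + 2) *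
        ((Q 0).eval z + (Q 1).eval z * f z + (Q 2).eval z * (f z) ^ 2)‖ ≤ C) :
    ∃ B : ℝ, ∀ᶠ s : ℝ in 𝓝[<] 0,
      ‖∑ p ∈ (Finset.univ : Finset (Fin 3)) ×ˢ Finset.range (n + 1),
        (cayleyTransform n (Q p.1)).coeff p.2 *
          Complex.exp (((p.1 : ℂ) * α + (p.2 : ℂ)) * s)‖ ≤ B * |s| ^ (3 * n + 2) := by
  obtain ⟨B, R, hBR⟩ := hrem
  refine ⟨B, ?_⟩
  have htop := tendsto_one_add_exp_div_one_sub_exp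
  filter_upwards [self_mem_nhdsWithin, htop.eventually_gt_atTop R] with s hs hsR
  have hs : s < 0 := hs
  rw [exp_sum_eq_of_branch hdeg hs (eval_eq_exp_of_branch hf hf1 hbranch htop hs)]
  have hE1 : 0 < 1 - Real.exp s := sub_pos.2 (Real.exp_lt_one_iff.2 hs)
  have hEs : 1 - Real.exp s ≤ |s| := by
    rw [abs_of_neg hs]; linarith [Real.add_one_le_exp s]
  set u := (1 + Real.exp s) / (1 - Real.exp s) with hu
  have hu0 : 0 < u := div_pos (by linarith [Real.exp_pos s]) hE1
  have hus : 1 ≤ u * |s| := by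
    calc (1 : ℝ) ≤ 1 + Real.exp s := by linarith [Real.exp_pos s]
      _ = u * (1 - Real.exp s) := by rw [hu]; field_simp
      _ ≤ u * |s| := mul_le_mul_of_nonneg_left hEs hu0.le
  have hnu : ‖(u : ℂ)‖ = u := by rw [Complex.norm_real, Real.norm_of_nonneg hu0.le]
  have hb := hBR u (by rwa [hnu])
  set r := (Q 0).eval (u : ℂ) + (Q 1).eval (u : ℂ) * f u + (Q 2).eval (u : ℂ) * f u ^ 2
  rw [norm_mul, norm_pow, hnu] at hb
  have hr : ‖r‖ ≤ B * |s| ^ (2 * n + 2) := by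
    calc ‖r‖ ≤ ‖r‖ * (u * |s|) ^ (2 * n + 2) :=
          le_mul_of_one_le_right (norm_nonneg _) (one_le_pow₀ hus)
      _ = u ^ (2 * n + 2) * ‖r‖ * |s| ^ (2 * n + 2) := by rw [mul_pow]; ring
      _ ≤ B * |s| ^ (2 * n + 2) := mul_le_mul_of_nonneg_right hb (by positivity)
  rw [norm_mul, norm_pow, Complex.norm_real, Real.norm_of_nonneg hE1.le]
  calc (1 - Real.exp s) ^ n * ‖r‖ ≤ |s| ^ n * (B * |s| ^ (2 * n + 2)) :=
        mul_le_mul (pow_le_pow_left₀ hE1.le hEs n) hr (norm_nonneg _) (by positivity)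
    _ = B * |s| ^ (3 * n + 2) := by
        rw [show 3 * n + 2 = n + (2 * n + 2) by ring, pow_add]; ring

/-- For `f(z) = ((z−1)/(z+1))^α` with `α ∈ (0, 1/2)` (the branch
holomorphic on `ℂ \ [−1,1]` with `f(∞) = 1`, characterized by `(z²−1) f' = 2α f` and
`f → 1` at `∞`), all zeros of each Hermite–Padé polynomial `Q_{n,j}` of order `n` for
`(1, f, f²)` lie in `ℝ \ [−1, 1]`. -/
theorem stmt_13
    (α : ℝ) (hα0 : 0 < α) (hα1 : α < 1 / 2)
    (f : ℂ → ℂ)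
    (hf : DifferentiableOn ℂ f {z : ℂ | ¬(z.im = 0 ∧ -1 ≤ z.re ∧ z.re ≤ 1)})
    (hf1 : Filter.Tendsto f (Bornology.cobounded ℂ) (nhds 1))
    (hbranch : ∀ z : ℂ, ¬(z.im = 0 ∧ -1 ≤ z.re ∧ z.re ≤ 1) →
      (z ^ 2 - 1) * deriv f z = 2 * (α : ℂ) * f z)
    (n : ℕ) (Q : Fin 3 → Polynomial ℂ)
    (hne : ¬ ∀ j, Q j = 0)
    (hdeg : ∀ j, (Q j).natDegree ≤ n)
    (hrem : ∃ C R' : ℝ, ∀ z : ℂ, R' < ‖z‖ →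
      ‖z ^ (2 * n + 2) *
        ((Q 0).eval z + (Q 1).eval z * f z + (Q 2).eval z * (f z) ^ 2)‖ ≤ C) :
    ∀ j, ∀ z : ℂ, (Q j).IsRoot z → z.im = 0 ∧ (z.re < -1 ∨ 1 < z.re) := by
  set S := (Finset.univ : Finset (Fin 3)) ×ˢ Finset.range (n + 1) with hS
  set lam : Fin 3 × ℕ → ℂ := fun p => (p.1 : ℂ) * α + (p.2 : ℂ) with hlam
  set c : Fin 3 × ℕ → ℂ := fun p => (cayleyTransform n (Q p.1)).coeff p.2 with hc
  have hcard : S.card = 3 * (n + 1) := by simp [hS]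
  have hmem : ∀ (j : Fin 3) (k : ℕ), k ≤ n → (j, k) ∈ S := fun j k hk => by simp [hS, hk]
  obtain ⟨B, hB⟩ := eventually_norm_exp_sum_le hf hf1 hbranch hdeg hrem
  have hmom := moments_eq_zero_of_exp_sum_le S lam c (3 * n + 2) B hB
  have hprod : ∀ i ∈ S, ∀ i' ∈ S, c i * ∏ l ∈ S.erase i, (lam i - lam l) =
      c i' * ∏ l ∈ S.erase i', (lam i' - lam l) := fun i hi i' hi' =>
    mul_prod_sub_eq_of_moments S lam c (fun m hm => hmom m (by omega)) hi hi'
  set D : Fin 3 × ℕ → ℂ := fun p => ∏ l ∈ S.erase p, (lam p - lam l) with hD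
  have hbound : ∀ i j : Fin 3, |((j : ℝ) - i) * α| < 1 := by
    intro i j
    have h1 : |((j : ℝ) - i)| ≤ 2 := by
      have hi : ((i : ℕ) : ℝ) ≤ 2 := by exact_mod_cast Nat.lt_succ_iff.1 i.isLt
      have hj : ((j : ℕ) : ℝ) ≤ 2 := by exact_mod_cast Nat.lt_succ_iff.1 j.isLt
      have hi0 : (0 : ℝ) ≤ ((i : ℕ) : ℝ) := Nat.cast_nonneg _
      have hj0 : (0 : ℝ) ≤ ((j : ℕ) : ℝ) := Nat.cast_nonneg _
      rw [abs_le]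
      constructor <;> linarith
    rw [abs_mul, abs_of_pos hα0]
    nlinarith [abs_nonneg ((j : ℝ) - i)]
  have hfac : ∀ i j : Fin 3, (if i = j then 1 else ((((j : ℝ) - i) * α : ℝ) : ℂ)) ≠ 0 := by
    intro i j
    split_ifs with hij
    · exact one_ne_zero
    · have : (j : ℝ) - i ≠ 0 := by
        rw [sub_ne_zero]
        intro h
        exact hij (Fin.ext (by exact_mod_cast h.symm))
      exact_mod_cast mul_ne_zero this hα0.ne'
  have hDval : ∀ (j : Fin 3) (k : ℕ), k ≤ n → D (j, k) = _ := fun j k hk =>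
    prod_erase_exponents (α := α) hk j
  have hD0 : ∀ (j : Fin 3) (k : ℕ), k ≤ n → D (j, k) ≠ 0 := by
    intro j k hk
    rw [hDval j k hk]
    refine Finset.prod_ne_zero_iff.2 fun i _ => mul_ne_zero (hfac i j) (mul_ne_zero ?_
      (mul_ne_zero (pow_ne_zero _ (by norm_num)) ?_))
    · exact shiftedRising_ne_zero (abs_lt.1 (hbound i j)).1 k
    · exact shiftedRising_ne_zero (neg_lt_neg (abs_lt.1 (hbound i j)).2) _
  set κ := c (0, 0) * D (0, 0) with hκ
  have hcD : ∀ (j : Fin 3) (k : ℕ), k ≤ n → c (j, k) * D (j, k) = κ := fun j k hk =>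
    hprod _ (hmem j k hk) _ (hmem 0 0 (Nat.zero_le n))
  have hκ0 : κ ≠ 0 := by
    intro h0
    refine hne fun j => eq_zero_of_cayleyTransform_eq_zero (hdeg j) ?_
    ext k
    rw [coeff_zero]
    rcases le_or_gt k n with hk | hk
    · exact (mul_eq_zero.1 ((hcD j k hk).trans h0)).resolve_right (hD0 j k hk)
    · exact coeff_eq_zero_of_natDegree_lt ((natDegree_cayleyTransform_le n _).trans_lt hk)
  intro j z hz
  obtain ⟨i₁, i₂, h₁, h₂, hF⟩ : ∃ i₁ i₂ : Fin 3, i₁ ≠ j ∧ i₂ ≠ j ∧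
      ∀ F : Fin 3 → ℂ, ∏ i, F i = F j * F i₁ * F i₂ := by
    fin_cases j
    · exact ⟨1, 2, by decide, by decide, fun F => Fin.prod_univ_three F⟩
    · exact ⟨0, 2, by decide, by decide, fun F => (Fin.prod_univ_three F).trans
        (show F 0 * F 1 * F 2 = F 1 * F 0 * F 2 by ring)⟩
    · exact ⟨0, 1, by decide, by decide, fun F => (Fin.prod_univ_three F).trans
        (show F 0 * F 1 * F 2 = F 2 * F 0 * F 1 by ring)⟩
  have hf₁ := hfac i₁ j
  have hf₂ := hfac i₂ j
  rw [if_neg h₁] at hf₁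
  rw [if_neg h₂] at hf₂
  set b₁ : ℝ := ((j : ℝ) - i₁) * α with hb₁
  set b₂ : ℝ := ((j : ℝ) - i₂) * α with hb₂
  obtain ⟨hd, hP⟩ := hasPosRoots_of_shiftedRising_mul_eq
    (natDegree_cayleyTransform_le n (Q j)) (hbound i₁ j) (hbound i₂ j)
    (div_ne_zero hκ0 (mul_ne_zero hf₁ hf₂)) fun k hk => by
      have e := hcD j k hk
      rw [hDval j k hk, hF, if_pos rfl, if_neg h₁, if_neg h₂, ← hb₁, ← hb₂] at e
      simp only [sub_self, zero_mul, neg_zero, Complex.ofReal_zero, one_mul, hc] at e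
      have hs : ((-1 : ℂ) ^ (n - k)) ^ 2 = 1 := by rw [← pow_mul, mul_comm, pow_mul]; simp
      rw [mul_div_assoc', eq_div_iff (mul_ne_zero hf₁ hf₂), ← e]
      generalize (-1 : ℂ) ^ (n - k) = σ at hs
      set A := shiftedRising b₁ k * shiftedRising (-b₁ : ℝ) (n - k) *
        (shiftedRising b₂ k * shiftedRising (-b₂ : ℝ) (n - k)) *
        (shiftedRising 0 k * shiftedRising 0 (n - k)) *
          (cayleyTransform n (Q j)).coeff k * (b₁ * b₂) with hA
      linear_combination (-(σ ^ 2 + 1) * A) * hs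
  exact isRoot_real_of_hasPosRoots_cayleyTransform (hdeg j) hP hd hz
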